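/- Let k, n, m, q be positive integers, ε ∈ (0,1/2), and δ, α, β, γ > 0 be such that n ≥ k·log₂ q + 2·log₂(1/δ), β ≥ √(2·ln(2n(1+1/ε))/π)/q, α = √(2n)·β, and γ = √n·β. Then there exist three randomized transformations producing, from any adversary A for binLWE_{n,m,q,≤α} (an arbitrary, not necessarily efficient, randomized distinguisher), adversaries B₁ for extLWE^m_{k,n,q,β,{0,1}ⁿ}, B₂ for LWE_{k,m,q,γ}, and B₃ for extLWE^m_{k,n,q,β,{0ⁿ}}, such that Adv[A] ≤ Adv[B₁] + Adv[B₂] + Adv[B₃] + 4mε + δ. -/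

import Mathlib

open MeasureTheory ProbabilityTheory

noncomputable section

namespace LWEPaper

/-- The torus `𝕋 = ℝ/ℤ`. -/
abbrev 𝕋 : Type := UnitAddCircle

/-- Embedding of `T_q = {0, 1/q, …, (q−1)/q} ⊆ 𝕋` (represented by `ZMod q`) into `𝕋`,
sending `x mod q` to `x/q mod 1`. -/
noncomputable def toT {q : ℕ} [NeZero q] (x : ZMod q) : 𝕋 := ZMod.toAddCircle x

/-- The continuous Gaussian `D_α` on `ℝ`, with density proportional to `exp (−π x² / α²)`
(for `α > 0`; it is the Gaussian measure with mean `0` and variance `α²/(2π)`). -/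
@[reducible] noncomputable def contGauss (α : ℝ) : Measure ℝ :=
  gaussianReal 0 (α ^ 2 / (2 * Real.pi)).toNNReal

/-- The sample space `T_qⁿ × 𝕋` of the LWE problem, with `T_qⁿ` represented by
`(ZMod q)ⁿ`. -/
abbrev Samp (n q : ℕ) : Type := (Fin n → ZMod q) × 𝕋

/-- The uniform (Haar/Lebesgue) probability distribution on `𝕋`. -/
noncomputable def uniT : Measure 𝕋 := volume

/-- The LWE distribution `A_{q,s,φ}` on `T_qⁿ × 𝕋`: choose `a` uniformly in `T_qⁿ`,
`e` from the error distribution `φ`, and output `(a, ⟨a,s⟩ + e mod 1)`. -/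
noncomputable def lweA (n q : ℕ) [NeZero q] (s : Fin n → ZMod q) (φ : Measure ℝ) :
    Measure (Samp n q) :=
  (((PMF.uniformOfFintype (Fin n → ZMod q)).toMeasure).prod φ).map
    fun ae => (ae.1, toT (∑ j, ae.1 j * s j) + ((ae.2 : ℝ) : 𝕋))

/-- `m` i.i.d. samples from `A_{q,s,φ}` (with the same secret `s` in every sample). -/
noncomputable def lweSamples (n m q : ℕ) [NeZero q] (s : Fin n → ZMod q) (φ : Measure ℝ) :
    Measure (Fin m → Samp n q) :=
  Measure.pi fun _ : Fin m => lweA n q s φ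

/-- The uniform distribution on `T_qⁿ × 𝕋`. -/
noncomputable def uniSamp (n q : ℕ) [NeZero q] : Measure (Samp n q) :=
  ((PMF.uniformOfFintype (Fin n → ZMod q)).toMeasure).prod uniT

/-- `m` i.i.d. uniform samples from `T_qⁿ × 𝕋`. -/
noncomputable def uniSamples (n m q : ℕ) [NeZero q] : Measure (Fin m → Samp n q) :=
  Measure.pi fun _ : Fin m => uniSamp n q

/-- The advantage of a (randomized) distinguisher, described by its acceptance-probability
function `f`, in distinguishing the distributions `P₀` and `P₁`. -/
noncomputable def adv {X : Type*} [MeasurableSpace X] (f : X → ℝ) (P₀ P₁ : Measure X) : ℝ :=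
  |(∫ x, f x ∂P₀) - ∫ x, f x ∂P₁|

/-- A distinguisher: a measurable acceptance-probability function with values in `[0,1]`
(this models an arbitrary, possibly randomized and not necessarily efficient,
`{0,1}`-valued algorithm). -/
def IsDistinguisher {X : Type*} [MeasurableSpace X] (f : X → ℝ) : Prop :=
  Measurable f ∧ ∀ x, f x ∈ Set.Icc (0 : ℝ) 1

/-- Applying a randomized transformation (Markov kernel) `κ` independently to each of the
`m` samples. -/
noncomputable def samplewise {S S' : Type*} [MeasurableSpace S] [MeasurableSpace S'] (m : ℕ)
    (κ : Kernel S S') (x : Fin m → S) : Measure (Fin m → S') :=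
  Measure.pi fun i => κ (x i)

/-- Euclidean norm of an integer vector. -/
noncomputable def inorm {n : ℕ} (s : Fin n → ℤ) : ℝ := Real.sqrt (∑ i, ((s i : ℝ)) ^ 2)

/-- Reduction of an integer vector modulo `q`. -/
def modq {n : ℕ} (q : ℕ) (s : Fin n → ℤ) : Fin n → ZMod q := fun i => ((s i : ℤ) : ZMod q)

/-- The statistical distance between two measures: the supremum, over measurable events,
of the discrepancy of the two measures (for probability measures this equals half the
total variation of their difference). -/
noncomputable def statDist {Ω : Type*} [MeasurableSpace Ω] (μ ν : Measure Ω) : ℝ :=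
  ⨆ A : { s : Set Ω // MeasurableSet s }, |(μ A).toReal - (ν A).toReal|

/-- A distribution `𝒟` on `ℤⁿ` is `(R,δ)`-bounded if the probability that a vector drawn
from `𝒟` has euclidean norm greater than `R` is at most `δ`. -/
def IsBounded {n : ℕ} (𝒟 : PMF (Fin n → ℤ)) (R δ : ℝ) : Prop :=
  (𝒟.toMeasure {x | R < inorm x}).toReal ≤ δ

/-- Matrices over a measurable space of entries are measurable spaces (with the product
σ-algebra, entrywise). -/
instance {k n q : ℕ} : MeasurableSpace (Matrix (Fin k) (Fin n) (ZMod q)) :=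
  inferInstanceAs (MeasurableSpace (Fin k → Fin n → ZMod q))

/-- Euclidean norm of an `m × n` integer array, viewed as a vector in `ℤ^{m·n}`. -/
noncomputable def gnorm {m n : ℕ} (x : Fin m → Fin n → ℤ) : ℝ :=
  Real.sqrt (∑ i, ∑ j, ((x i j : ℝ)) ^ 2)

/-- `dg` is the discrete Gaussian distribution `D_{ℤ^{m·n},r}`: a probability
distribution whose mass function is proportional to `ρ_r(x) = exp(−π‖x‖²/r²)` (expressed
by cross-proportionality, which determines the distribution uniquely).  Since the
Gaussian function factors over coordinates, this is exactly the distribution of `m`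
independent samples from `D_{ℤⁿ,r}`, and under the scaling `x ↦ x/q` it represents `m`
independent samples from `D_{q⁻¹ℤⁿ, r/q}`. -/
def IsDiscreteGaussian {m n : ℕ} (dg : PMF (Fin m → Fin n → ℤ)) (r : ℝ) : Prop :=
  ∀ x y : Fin m → Fin n → ℤ,
    (dg x).toReal * Real.exp (-Real.pi * (gnorm y) ^ 2 / r ^ 2)
      = (dg y).toReal * Real.exp (-Real.pi * (gnorm x) ^ 2 / r ^ 2)

/-- The `extLWE^m_{k,n,q,β,Z}` distribution for hint vector `z`, LWE case: the output is
`(A, (bᵢ = Aᵀsᵢ + eᵢ)_{i∈[m]}, (⟨eᵢ,z⟩)_{i∈[m]})` where `A` is uniform in `T_q^{k×n}`,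
the `sᵢ` are uniform in `{0,…,q−1}^k` and the `eᵢ` are i.i.d. from `D_{q⁻¹ℤⁿ,β}`.
Everything is scaled by `q`: `A, bᵢ` are represented over `ZMod q`, the noise vectors are
represented by `(q·eᵢ)ᵢ ← dgm = D_{ℤ^{m×n},qβ}`, and the hints `⟨eᵢ,z⟩ ∈ q⁻¹ℤ` are
represented by their numerators `⟨q·eᵢ, z⟩ ∈ ℤ`. -/
noncomputable def extLWEm₀ (k n m q : ℕ) [NeZero q]
    (dgm : PMF (Fin m → Fin n → ℤ)) (z : Fin n → ℤ) :
    Measure (Matrix (Fin k) (Fin n) (ZMod q) × (Fin m → Fin n → ZMod q) × (Fin m → ℤ)) :=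
  ((PMF.uniformOfFintype (Matrix (Fin k) (Fin n) (ZMod q))).bind fun A =>
    (PMF.uniformOfFintype (Fin m → Fin k → ZMod q)).bind fun S =>
      dgm.bind fun E =>
        PMF.pure (A, fun i j => A.transpose.mulVec (S i) j + ((E i j : ℤ) : ZMod q),
          fun i => ∑ j, z j * E i j)).toMeasure

/-- The `extLWE^m_{k,n,q,β,Z}` distribution for hint vector `z`, uniform case: as in
`extLWEm₀` but with the `bᵢ` uniform in `T_qⁿ` and independent of everything else (the
hints `⟨eᵢ,z⟩` are still given). -/
noncomputable def extLWEm₁ (k n m q : ℕ) [NeZero q]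
    (dgm : PMF (Fin m → Fin n → ℤ)) (z : Fin n → ℤ) :
    Measure (Matrix (Fin k) (Fin n) (ZMod q) × (Fin m → Fin n → ZMod q) × (Fin m → ℤ)) :=
  ((PMF.uniformOfFintype (Matrix (Fin k) (Fin n) (ZMod q))).bind fun A =>
    (PMF.uniformOfFintype (Fin m → Fin n → ZMod q)).bind fun B =>
      dgm.bind fun E =>
        PMF.pure (A, B, fun i => ∑ j, z j * E i j)).toMeasure

/-- The `binLWE` distribution on `m` samples: the secret `z` is uniform over `{0,1}ⁿ` and,
given `z`, the samples are i.i.d. from `A_{q,z,D_{αf z}}`, for a noise level `αf z`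
possibly depending on the secret. -/
noncomputable def binLWESamples (n m q : ℕ) [NeZero q] (αf : (Fin n → Bool) → ℝ) :
    Measure (Fin m → Samp n q) :=
  (PMF.uniformOfFintype (Fin n → Bool)).toMeasure.bind fun z =>
    lweSamples n m q (fun i => if z i then (1 : ZMod q) else 0) (contGauss (αf z))

/-- The standard LWE distribution on `m` samples: the secret is uniform over
`{0,…,q−1}^k` and, given the secret, the samples are i.i.d. from `A_{q,s,D_γ}`. -/
noncomputable def stdLWESamples (k m q : ℕ) [NeZero q] (γ : ℝ) :
    Measure (Fin m → Samp k q) :=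
  (PMF.uniformOfFintype (Fin k → ZMod q)).toMeasure.bind fun sec =>
    lweSamples k m q sec (contGauss γ)

section

lemma abs_tsum_gaussian_sub_le {s : ℝ} (hs : 0 < s) (c : ℝ) :
    |(∑' n : ℤ, Real.exp (-Real.pi / s ^ 2 * (n + c) ^ 2)) - s| ≤
      s * (2 * Real.exp (-Real.pi * s ^ 2) / (1 - Real.exp (-Real.pi * s ^ 2))) := by
  set x := Real.exp (-Real.pi * s ^ 2) with hx
  have hx0 : 0 < x := Real.exp_pos _
  have hx1 : x < 1 := by
    rw [hx, Real.exp_lt_one_iff, neg_mul, neg_lt_zero]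
    positivity
  let F : ℤ → ℂ := fun n => Complex.exp (-Real.pi * (s ^ 2 : ℝ) * n ^ 2 + 2 * Real.pi * (-Complex.I * c) * n)
  let G : ℤ → ℝ := fun n => if n = 0 then 0 else x ^ n.natAbs
  have hnorm (n : ℤ) : ‖F n‖ = Real.exp (-Real.pi * s ^ 2 * n ^ 2) := by
    simp only [F, Complex.norm_exp]
    congr 1
    simp [← Complex.ofReal_pow, ← Complex.ofReal_intCast, -Complex.ofReal_mul]
  have hgeo : HasSum (fun n : ℕ => x ^ (n + 1)) (x / (1 - x)) := by
    simpa [pow_succ', div_eq_mul_inv] using (hasSum_geometric_of_lt_one hx0.le hx1).mul_left x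
  have hG : HasSum G (2 * x / (1 - x)) := by
    have h1 : HasSum (fun n : ℕ => G (n + 1)) (x / (1 - x)) := by
      convert hgeo using 2 with n
      simp only [G]
      rw [if_neg (by omega)]
      rfl
    have h2 : HasSum (fun n : ℕ => G (-(n + 1))) (x / (1 - x)) := by
      convert hgeo using 2 with n
      simp only [G]
      rw [if_neg (by omega)]
      congr 1
    convert HasSum.of_add_one_of_neg_add_one h1 h2 using 1
    simp only [G, if_true]
    ring
  have hle (n : ℤ) : ‖F n - Pi.single (M := fun _ => ℂ) 0 1 n‖ ≤ G n := by
    by_cases hn : n = 0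
    · subst hn; simp [F, G]
    · simp only [G, if_neg hn, Pi.single_eq_of_ne hn, sub_zero, hnorm]
      rw [hx, ← Real.exp_nat_mul]
      apply Real.exp_le_exp.mpr
      have h1 : (n.natAbs : ℝ) ≤ (n : ℝ) ^ 2 := by
        rw [Nat.cast_natAbs, ← sq_abs, ← Int.cast_abs]
        exact_mod_cast Int.le_self_sq |n|
      have : 0 < Real.pi * s ^ 2 := by positivity
      nlinarith
  have hsingle : HasSum (Pi.single (M := fun _ : ℤ => ℂ) 0 1) 1 := hasSum_pi_single 0 1
  have hsub : Summable fun n => F n - Pi.single (M := fun _ => ℂ) 0 1 n :=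
    Summable.of_norm_bounded hG.summable hle
  have hF : Summable F := by simpa using hsub.add hsingle.summable
  have h1 : ‖(∑' n, F n) - 1‖ ≤ 2 * x / (1 - x) := by
    have := tsum_of_norm_bounded hG hle
    rwa [hF.tsum_sub hsingle.summable, hsingle.tsum_eq] at this
  have hpois := Complex.tsum_exp_neg_quadratic (a := ((s ^ 2 : ℝ) : ℂ))
    (by rw [Complex.ofReal_re]; positivity) (-Complex.I * c)
  have hroot : ((s ^ 2 : ℝ) : ℂ) ^ (1 / 2 : ℂ) = s := by
    have : ((1 / 2 : ℂ)) = ((1 / 2 : ℝ) : ℂ) := by norm_num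
    rw [this, ← Complex.ofReal_cpow (by positivity), ← Real.sqrt_eq_rpow, Real.sqrt_sq hs.le]
  have hterm (n : ℤ) : Complex.exp (-Real.pi / ((s ^ 2 : ℝ) : ℂ) * (n + Complex.I * (-Complex.I * c)) ^ 2)
      = ((Real.exp (-Real.pi / s ^ 2 * (n + c) ^ 2) : ℝ) : ℂ) := by
    push_cast
    congr 3
    rw [← mul_assoc, mul_neg, Complex.I_mul_I]
    ring
  simp_rw [hterm] at hpois
  rw [hroot, ← Complex.ofReal_tsum] at hpois
  change ∑' n, F n = _ at hpois
  rw [hpois] at h1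
  set Θ := ∑' n : ℤ, Real.exp (-Real.pi / s ^ 2 * (n + c) ^ 2)
  have h2 : ‖(1 / (s : ℂ)) * (Θ : ℂ) - 1‖ = |Θ - s| / s := by
    have : (1 / (s : ℂ)) * (Θ : ℂ) - 1 = (((Θ - s) / s : ℝ) : ℂ) := by
      push_cast; field_simp [hs.ne']
    rw [this, Complex.norm_real, Real.norm_eq_abs, abs_div, abs_of_pos hs]
  rw [h2, div_le_iff₀ hs] at h1
  linarith

variable {X Y Z : Type*} [MeasurableSpace X] [MeasurableSpace Y] [MeasurableSpace Z]

lemma IsDistinguisher.integrable {f : X → ℝ} (hf : IsDistinguisher f) (μ : Measure X)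
    [IsFiniteMeasure μ] : Integrable f μ :=
  Integrable.of_bound hf.1.aestronglyMeasurable 1
    (.of_forall fun x => abs_le.2 ⟨by linarith [(hf.2 x).1], (hf.2 x).2⟩)

lemma IsDistinguisher.integral_mem {f : X → ℝ} (hf : IsDistinguisher f) (μ : Measure X)
    [IsProbabilityMeasure μ] : ∫ x, f x ∂μ ∈ Set.Icc (0 : ℝ) 1 := by
  refine ⟨integral_nonneg fun x => (hf.2 x).1, ?_⟩
  calc ∫ x, f x ∂μ ≤ ∫ _, (1 : ℝ) ∂μ :=
        integral_mono (hf.integrable μ) (integrable_const _) fun x => (hf.2 x).2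
    _ = 1 := by simp

lemma IsDistinguisher.comp {f : Y → ℝ} (hf : IsDistinguisher f) {g : X → Y} (hg : Measurable g) :
    IsDistinguisher fun x => f (g x) :=
  ⟨hf.1.comp hg, fun x => hf.2 (g x)⟩

lemma IsDistinguisher.integral_right {f : X × Y → ℝ} (hf : IsDistinguisher f) (μ : Measure Y)
    [IsProbabilityMeasure μ] : IsDistinguisher fun x => ∫ y, f (x, y) ∂μ :=
  ⟨(hf.1.stronglyMeasurable.integral_prod_right' (ν := μ)).measurable,
    fun x => (hf.comp (measurable_prodMk_left (x := x))).integral_mem μ⟩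

lemma IsDistinguisher.integral_left {f : X × Y → ℝ} (hf : IsDistinguisher f) (μ : Measure X)
    [IsProbabilityMeasure μ] : IsDistinguisher fun y => ∫ x, f (x, y) ∂μ :=
  (hf.comp measurable_swap).integral_right μ

lemma IsDistinguisher.integral_prod {f : X × Y → ℝ} (hf : IsDistinguisher f) (μ : Measure X)
    (ν : Measure Y) [IsFiniteMeasure μ] [IsFiniteMeasure ν] :
    ∫ p, f p ∂(μ.prod ν) = ∫ x, ∫ y, f (x, y) ∂ν ∂μ :=
  MeasureTheory.integral_prod _ (hf.integrable _)

lemma IsDistinguisher.integral_swap {f : X × Y → ℝ} (hf : IsDistinguisher f) (μ : Measure X)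
    (ν : Measure Y) [IsFiniteMeasure μ] [IsFiniteMeasure ν] :
    ∫ x, ∫ y, f (x, y) ∂ν ∂μ = ∫ y, ∫ x, f (x, y) ∂μ ∂ν :=
  MeasureTheory.integral_integral_swap (hf.integrable _)

lemma IsDistinguisher.integral_map {f : Y → ℝ} (hf : IsDistinguisher f) {g : X → Y}
    (hg : Measurable g) (μ : Measure X) : ∫ y, f y ∂(μ.map g) = ∫ x, f (g x) ∂μ :=
  MeasureTheory.integral_map hg.aemeasurable hf.1.aestronglyMeasurable

lemma IsDistinguisher.integral_bind {f : Y → ℝ} (hf : IsDistinguisher f) (μ : Measure X)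
    {κ : X → Measure Y} (hκ : Measurable κ) [∀ x, IsProbabilityMeasure (κ x)] :
    ∫ y, f y ∂(μ.bind κ) = ∫ x, ∫ y, f y ∂(κ x) ∂μ := by
  have hlin (x : X) : ∫ y, f y ∂(κ x) = (∫⁻ y, ENNReal.ofReal (f y) ∂(κ x)).toReal :=
    integral_eq_lintegral_of_nonneg_ae (.of_forall fun y => (hf.2 y).1)
      hf.1.aestronglyMeasurable
  rw [integral_eq_lintegral_of_nonneg_ae (.of_forall fun y => (hf.2 y).1)
      hf.1.aestronglyMeasurable, Measure.lintegral_bind hκ.aemeasurable (by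
      have := hf.1; fun_prop),
    integral_eq_lintegral_of_nonneg_ae (.of_forall fun x => (hf.integral_mem (κ x)).1)]
  · congr 2 with x
    exact (ofReal_integral_eq_lintegral_ofReal (hf.integrable _)
      (.of_forall fun y => (hf.2 y).1)).symm
  · simp_rw [hlin]
    exact ((Measure.measurable_lintegral hf.1.ennreal_ofReal).comp
      hκ).ennreal_toReal.aestronglyMeasurable

lemma adv_integral_le {f : X × Y → ℝ} (hf : IsDistinguisher f) (μ : Measure X)
    [IsProbabilityMeasure μ] (P₀ P₁ : Measure Y) [IsProbabilityMeasure P₀]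
    [IsProbabilityMeasure P₁] {c : ℝ} (h : ∀ x, adv (fun y => f (x, y)) P₀ P₁ ≤ c) :
    |(∫ x, ∫ y, f (x, y) ∂P₀ ∂μ) - ∫ x, ∫ y, f (x, y) ∂P₁ ∂μ| ≤ c := by
  rw [← integral_sub ((hf.integral_right P₀).integrable μ) ((hf.integral_right P₁).integrable μ)]
  have := norm_integral_le_of_norm_le_const (μ := μ) (C := c)
    (f := fun x => (∫ y, f (x, y) ∂P₀) - ∫ y, f (x, y) ∂P₁) (.of_forall h)
  simpa using this

/-- Two distributions that no distinguisher separates with advantage more than `c`. -/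
def AdvClose (c : ℝ) (P₀ P₁ : Measure X) : Prop :=
  ∀ f : X → ℝ, IsDistinguisher f → adv f P₀ P₁ ≤ c

lemma AdvClose.refl (P : Measure X) : AdvClose 0 P P := fun f _ => by simp [adv]

lemma AdvClose.trans {c d : ℝ} {P Q R : Measure X} (h : AdvClose c P Q) (h' : AdvClose d Q R) :
    AdvClose (c + d) P R := fun f hf =>
  (abs_sub_le _ (∫ x, f x ∂Q) _).trans (add_le_add (h f hf) (h' f hf))

lemma AdvClose.map {c : ℝ} {P Q : Measure X} (h : AdvClose c P Q) {g : X → Y}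
    (hg : Measurable g) : AdvClose c (P.map g) (Q.map g) := fun f hf => by
  rw [adv, hf.integral_map hg, hf.integral_map hg]
  exact h _ (hf.comp hg)

lemma AdvClose.prod {c d : ℝ} {P P' : Measure X} {Q Q' : Measure Y} [IsProbabilityMeasure P]
    [IsProbabilityMeasure P'] [IsProbabilityMeasure Q] [IsProbabilityMeasure Q']
    (h : AdvClose c P P') (h' : AdvClose d Q Q') : AdvClose (c + d) (P.prod Q) (P'.prod Q') := by
  refine AdvClose.trans (Q := P'.prod Q) (fun f hf => ?_) fun f hf => ?_
  · rw [adv, hf.integral_prod, hf.integral_prod]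
    exact h _ (hf.integral_right Q)
  · rw [adv, hf.integral_prod, hf.integral_prod]
    exact adv_integral_le hf P' Q Q' fun x => h' _ (hf.comp measurable_prodMk_left)

lemma finCons_eq_piFinSuccAbove_symm {m : ℕ} :
    (fun p : X × (Fin m → X) => (Fin.cons p.1 p.2 : Fin (m + 1) → X)) =
      (MeasurableEquiv.piFinSuccAbove (fun _ : Fin (m + 1) => X) 0).symm := by
  funext p
  exact (Fin.insertNth_zero _ _).symm

lemma map_cons_pi {m : ℕ} (P : Measure X) [IsProbabilityMeasure P] :
    (P.prod (Measure.pi fun _ : Fin m => P)).map (fun p => (Fin.cons p.1 p.2 : Fin (m + 1) → X))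
      = Measure.pi fun _ : Fin (m + 1) => P := by
  rw [finCons_eq_piFinSuccAbove_symm]
  exact (measurePreserving_piFinSuccAbove (fun _ : Fin (m + 1) => P) 0).symm.map_eq

lemma measurable_finCons {m : ℕ} :
    Measurable fun p : X × (Fin m → X) => (Fin.cons p.1 p.2 : Fin (m + 1) → X) := by
  rw [finCons_eq_piFinSuccAbove_symm]
  exact (MeasurableEquiv.piFinSuccAbove (fun _ : Fin (m + 1) => X) 0).symm.measurable

lemma AdvClose.pi {c : ℝ} {P Q : Measure X} [IsProbabilityMeasure P] [IsProbabilityMeasure Q]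
    (h : AdvClose c P Q) (m : ℕ) :
    AdvClose (m * c) (Measure.pi fun _ : Fin m => P) (Measure.pi fun _ : Fin m => Q) := by
  induction m with
  | zero =>
    rw [Measure.pi_of_empty _ (fun i => i.elim0), Measure.pi_of_empty _ (fun i => i.elim0)]
    simpa using AdvClose.refl _
  | succ m ih =>
    rw [← map_cons_pi P, ← map_cons_pi Q]
    convert (h.prod ih).map measurable_finCons using 1
    push_cast; ring

lemma advClose_of_le {P Q : Measure X} [IsProbabilityMeasure P] [IsProbabilityMeasure Q] {c : ℝ}
    (hc : 0 ≤ c) (h : P ≤ ENNReal.ofReal (1 + c) • Q) : AdvClose c P Q := by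
  have key (f : X → ℝ) (hf : IsDistinguisher f) : (∫ x, f x ∂P) - ∫ x, f x ∂Q ≤ c := by
    have h1 : ∫ x, f x ∂P ≤ (1 + c) * ∫ x, f x ∂Q := by
      calc ∫ x, f x ∂P ≤ ∫ x, f x ∂(ENNReal.ofReal (1 + c) • Q) :=
            integral_mono_measure h (.of_forall fun x => (hf.2 x).1)
              ((hf.integrable Q).smul_measure ENNReal.ofReal_ne_top)
        _ = _ := by
          rw [integral_smul_measure, ENNReal.toReal_ofReal (by linarith), smul_eq_mul]
    nlinarith [(hf.integral_mem Q).2]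
  intro f hf
  refine abs_sub_le_iff.2 ⟨key f hf, ?_⟩
  have hf' : IsDistinguisher fun x => 1 - f x :=
    ⟨measurable_const.sub hf.1, fun x => ⟨by linarith [(hf.2 x).2], by linarith [(hf.2 x).1]⟩⟩
  have := key _ hf'
  rw [integral_sub (integrable_const _) (hf.integrable _),
    integral_sub (integrable_const _) (hf.integrable _)] at this
  simpa using this

lemma summable_exp_gaussian {s : ℝ} (hs : 0 < s) (c : ℝ) :
    Summable fun n : ℤ => Real.exp (-Real.pi / s ^ 2 * (n + c) ^ 2) := by
  have h := ((summable_jacobiTheta₂_term_iff (Complex.I * (c / s ^ 2 : ℝ)) (Complex.I * (1 / s ^ 2 : ℝ))).2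
    (by rw [Complex.I_mul_im, Complex.ofReal_re]; positivity)).norm.mul_left
      (Real.exp (-Real.pi / s ^ 2 * c ^ 2))
  refine h.congr fun n => ?_
  rw [norm_jacobiTheta₂_term, ← Real.exp_add, Complex.I_mul_im, Complex.I_mul_im,
    Complex.ofReal_re, Complex.ofReal_re]
  congr 1
  field_simp
  ring

lemma gaussianPDFReal_contGauss {σ : ℝ} (hσ : 0 < σ) (a y : ℝ) :
    gaussianPDFReal a (σ ^ 2 / (2 * Real.pi)).toNNReal y =
      σ⁻¹ * Real.exp (-Real.pi / σ ^ 2 * (y - a) ^ 2) := by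
  rw [gaussianPDFReal_def, Real.coe_toNNReal _ (by positivity)]
  have h1 : 2 * Real.pi * (σ ^ 2 / (2 * Real.pi)) = σ ^ 2 := by field_simp
  dsimp only
  rw [h1, Real.sqrt_sq hσ.le]
  congr 2
  field_simp

lemma toNNReal_var_ne_zero {σ : ℝ} (hσ : 0 < σ) : (σ ^ 2 / (2 * Real.pi)).toNNReal ≠ 0 :=
  (Real.toNNReal_pos.2 (by positivity)).ne'

/-- The one-dimensional discrete Gaussian distribution `D_{ℤ,r}`. -/
def intGauss (r : ℝ) (hr : 0 < r) : PMF ℤ :=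
  PMF.normalize (fun j => ENNReal.ofReal (Real.exp (-Real.pi / r ^ 2 * (j : ℝ) ^ 2)))
    (fun h => by
      have := ENNReal.tsum_eq_zero.1 h 0
      simp at this)
    (by
      rw [← ENNReal.ofReal_tsum_of_nonneg (fun _ => (Real.exp_pos _).le)
        (by simpa using summable_exp_gaussian hr 0)]
      exact ENNReal.ofReal_ne_top)

lemma exists_intGauss_apply (r : ℝ) (hr : 0 < r) : ∃ K : ℝ, 0 < K ∧ ∀ j, intGauss r hr j =
    ENNReal.ofReal (K * Real.exp (-Real.pi / r ^ 2 * (j : ℝ) ^ 2)) := by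
  have hsum : Summable fun j : ℤ => Real.exp (-Real.pi / r ^ 2 * (j : ℝ) ^ 2) := by
    simpa using summable_exp_gaussian hr 0
  have hpos := hsum.tsum_pos (fun _ => (Real.exp_pos _).le) 0 (Real.exp_pos _)
  refine ⟨_, inv_pos.2 hpos, fun j => ?_⟩
  rw [intGauss, PMF.normalize_apply,
    ← ENNReal.ofReal_tsum_of_nonneg (fun _ => (Real.exp_pos _).le) hsum, mul_comm,
    ENNReal.ofReal_mul (inv_pos.2 hpos).le, ENNReal.ofReal_inv_of_pos hpos]

/-- If the density of a probability measure `P` relative to a reference measure is, up to a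
constant factor, within `1 ± e` of that of a probability measure `Q`, then `P` is close to `Q`. -/
lemma advClose_withDensity {X : Type*} [MeasurableSpace X] {μ : Measure X} {g D : X → ℝ}
    {κ e : ℝ} (hg : ∀ x, 0 ≤ g x) (he : 0 ≤ e) (he' : e ≤ 1 / 2) (hκ : 0 ≤ κ)
    [IsProbabilityMeasure (μ.withDensity fun x => ENNReal.ofReal (D x))]
    [IsProbabilityMeasure (μ.withDensity fun x => ENNReal.ofReal (g x))]
    (hlow : ∀ x, κ * (1 - e) * g x ≤ D x) (hupp : ∀ x, D x ≤ κ * (1 + e) * g x) :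
    AdvClose (4 * e) (μ.withDensity fun x => ENNReal.ofReal (D x))
      (μ.withDensity fun x => ENNReal.ofReal (g x)) := by
  have hκ1 : κ * (1 - e) ≤ 1 := by
    have h1 : ENNReal.ofReal (κ * (1 - e)) • (μ.withDensity fun x => ENNReal.ofReal (g x)) ≤
        μ.withDensity fun x => ENNReal.ofReal (D x) := by
      rw [← withDensity_smul' _ _ ENNReal.ofReal_ne_top]
      refine withDensity_mono (.of_forall fun x => ?_)
      rw [Pi.smul_apply, smul_eq_mul, ← ENNReal.ofReal_mul (by nlinarith)]
      exact ENNReal.ofReal_le_ofReal (hlow x)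
    have h2 := h1 Set.univ
    rw [Measure.smul_apply, measure_univ, measure_univ, smul_eq_mul, mul_one] at h2
    exact ENNReal.ofReal_le_one.1 h2
  refine advClose_of_le (by positivity) ?_
  rw [← withDensity_smul' _ _ ENNReal.ofReal_ne_top]
  refine withDensity_mono (.of_forall fun x => ?_)
  rw [Pi.smul_apply, smul_eq_mul, ← ENNReal.ofReal_mul (by positivity)]
  refine ENNReal.ofReal_le_ofReal ((hupp x).trans ?_)
  gcongr
  · exact hg x
  · nlinarith

lemma advClose_intGauss_add_contGauss {q r σ e : ℝ} (hq : 0 < q) (hr : 0 < r) (hσ : 0 < σ)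
    (he : e ≤ 1 / 2)
    (hs : 2 * Real.exp (-Real.pi * (r ^ 2 * (q * σ) ^ 2 / (r ^ 2 + (q * σ) ^ 2))) /
      (1 - Real.exp (-Real.pi * (r ^ 2 * (q * σ) ^ 2 / (r ^ 2 + (q * σ) ^ 2)))) ≤ e) :
    AdvClose (4 * e)
      (((intGauss r hr).toMeasure.prod (contGauss σ)).map fun p => -(p.1 : ℝ) / q + p.2)
      (contGauss (Real.sqrt (σ ^ 2 + (r / q) ^ 2))) := by
  obtain ⟨K, hK, hKj⟩ := exists_intGauss_apply r hr
  set τ := Real.sqrt (σ ^ 2 + (r / q) ^ 2) with hτdef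
  have hτ : 0 < τ := Real.sqrt_pos.2 (by positivity)
  have hτ2 : τ ^ 2 = σ ^ 2 + (r / q) ^ 2 := Real.sq_sqrt (by positivity)
  set s := r * (q * σ) / (q * τ) with hsdef
  have hs0 : 0 < s := by positivity
  have hs2 : s ^ 2 = r ^ 2 * (q * σ) ^ 2 / (r ^ 2 + (q * σ) ^ 2) := by
    rw [hsdef, div_pow, mul_pow q τ, hτ2, mul_pow r]
    congr 1
    field_simp
    ring
  rw [← hs2] at hs
  have he0 : 0 ≤ e := by
    refine le_trans ?_ hs
    have : Real.exp (-Real.pi * s ^ 2) ≤ 1 :=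
      Real.exp_le_one_iff.2 (by rw [neg_mul, neg_nonpos]; positivity)
    exact div_nonneg (by positivity) (by linarith)
  let Θ : ℝ → ℝ := fun y =>
    ∑' n : ℤ, Real.exp (-Real.pi / s ^ 2 * (n + y * r ^ 2 / (q * τ ^ 2)) ^ 2)
  let g : ℝ → ℝ := gaussianPDFReal 0 (τ ^ 2 / (2 * Real.pi)).toNNReal
  let κ : ℝ := K * s * τ / σ
  let D : ℝ → ℝ := fun y => κ * g y * (Θ y / s)
  have hg (y : ℝ) : g y = τ⁻¹ * Real.exp (-Real.pi / τ ^ 2 * y ^ 2) := by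
    simp [g, gaussianPDFReal_contGauss hτ]
  have hΘ (y : ℝ) : |Θ y / s - 1| ≤ e := by
    have h1 := abs_tsum_gaussian_sub_le hs0 (y * r ^ 2 / (q * τ ^ 2))
    have : Θ y / s - 1 = (Θ y - s) / s := by field_simp
    rw [this, abs_div, abs_of_pos hs0, div_le_iff₀ hs0, mul_comm e]
    exact h1.trans (by gcongr)
  have hQ : contGauss τ = volume.withDensity fun y => ENNReal.ofReal (g y) :=
    gaussianReal_of_var_ne_zero _ (toNNReal_var_ne_zero hτ)
  have hterm (y : ℝ) (j : ℤ) : K * Real.exp (-Real.pi / r ^ 2 * (j : ℝ) ^ 2) *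
      gaussianPDFReal (-(j : ℝ) / q) (σ ^ 2 / (2 * Real.pi)).toNNReal y =
      κ * g y / s * Real.exp (-Real.pi / s ^ 2 * (j + y * r ^ 2 / (q * τ ^ 2)) ^ 2) := by
    rw [gaussianPDFReal_contGauss hσ, hg]
    have h1 : Real.exp (-Real.pi / r ^ 2 * (j : ℝ) ^ 2) *
        Real.exp (-Real.pi / σ ^ 2 * (y - -(j : ℝ) / q) ^ 2) =
        Real.exp (-Real.pi / τ ^ 2 * y ^ 2) *
          Real.exp (-Real.pi / s ^ 2 * (j + y * r ^ 2 / (q * τ ^ 2)) ^ 2) := by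
      rw [← Real.exp_add, ← Real.exp_add, hs2, hτ2]
      congr 1
      have : r ^ 2 + (q * σ) ^ 2 ≠ 0 := by positivity
      field_simp
      ring
    calc _ = K * σ⁻¹ * (Real.exp (-Real.pi / r ^ 2 * (j : ℝ) ^ 2) *
        Real.exp (-Real.pi / σ ^ 2 * (y - -(j : ℝ) / q) ^ 2)) := by ring
      _ = _ := by
        rw [h1]
        simp only [κ]
        field_simp
  have hP : ((intGauss r hr).toMeasure.prod (contGauss σ)).map
      (fun p => -(p.1 : ℝ) / q + p.2) = volume.withDensity fun y => ENNReal.ofReal (D y) := by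
    have hmeas : Measurable fun p : ℤ × ℝ => -(p.1 : ℝ) / q + p.2 := by fun_prop
    ext A hA
    rw [Measure.map_apply hmeas hA, Measure.prod_apply (hmeas hA), lintegral_countable',
      withDensity_apply _ hA]
    have hj (j : ℤ) : contGauss σ (Prod.mk j ⁻¹' ((fun p : ℤ × ℝ => -(p.1 : ℝ) / q + p.2) ⁻¹' A)) *
        (intGauss r hr).toMeasure {j} = ∫⁻ y in A, ENNReal.ofReal
          (κ * g y / s * Real.exp (-Real.pi / s ^ 2 * (j + y * r ^ 2 / (q * τ ^ 2)) ^ 2)) := by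
      rw [PMF.toMeasure_apply_singleton _ _ (measurableSet_singleton j), hKj, mul_comm]
      have h2 : contGauss σ (Prod.mk j ⁻¹' ((fun p : ℤ × ℝ => -(p.1 : ℝ) / q + p.2) ⁻¹' A)) =
          gaussianReal (-(j : ℝ) / q) (σ ^ 2 / (2 * Real.pi)).toNNReal A := by
        have h3 := gaussianReal_map_const_add (μ := 0)
          (v := (σ ^ 2 / (2 * Real.pi)).toNNReal) (-(j : ℝ) / q)
        rw [zero_add] at h3
        rw [← h3, Measure.map_apply (by fun_prop) hA]
        rfl
      rw [h2, gaussianReal_apply _ (toNNReal_var_ne_zero hσ), ← lintegral_const_mul _ (by fun_prop)]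
      refine lintegral_congr fun y => ?_
      rw [gaussianPDF, ← ENNReal.ofReal_mul (by positivity), hterm]
    simp_rw [hj]
    rw [← lintegral_tsum (fun j => by
      have : Measurable g := measurable_gaussianPDFReal _ _
      fun_prop)]
    refine lintegral_congr fun y => ?_
    have hg0 : 0 ≤ g y := gaussianPDFReal_nonneg _ _ _
    rw [← ENNReal.ofReal_tsum_of_nonneg (fun j => by positivity)
      ((summable_exp_gaussian hs0 _).mul_left _), tsum_mul_left]
    congr 1
    simp only [D, Θ]
    ring
  have : IsProbabilityMeasure (((intGauss r hr).toMeasure.prod (contGauss σ)).map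
      (fun p => -(p.1 : ℝ) / q + p.2)) :=
    Measure.isProbabilityMeasure_map (by fun_prop)
  have hQp : IsProbabilityMeasure (contGauss τ) := inferInstance
  rw [hP] at this ⊢
  rw [hQ] at hQp ⊢
  refine advClose_withDensity (κ := κ) (fun y => gaussianPDFReal_nonneg _ _ _) he0 he
    (by positivity) (fun y => ?_) fun y => ?_
  all_goals
    have hg0 : 0 ≤ g y := gaussianPDFReal_nonneg _ _ _
    have hκ : 0 ≤ κ := by positivity
    have h1 := abs_le.1 (hΘ y)
    have h2 := mul_nonneg hκ hg0
    simp only [D]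
    nlinarith

instance (σ : ℝ) : IsProbabilityMeasure (contGauss σ) := inferInstance

/-- The law of `-⟨v, z⟩ / q + e`, where the coordinates of `v` are independent with law `G` and
`e` has law `contGauss σ`. -/
def hintNoise {n : ℕ} (q σ : ℝ) (G : Measure ℤ) (z : Fin n → Bool) : Measure ℝ :=
  ((Measure.pi fun _ : Fin n => G).prod (contGauss σ)).map
    fun p => -((∑ j, (if z j then 1 else 0) * p.1 j : ℤ) : ℝ) / q + p.2

lemma measurable_hintNoise {n : ℕ} (q : ℝ) (z : Fin n → Bool) : Measurable
    fun p : (Fin n → ℤ) × ℝ => -((∑ j, (if z j then 1 else 0) * p.1 j : ℤ) : ℝ) / q + p.2 :=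
  Measurable.add (((Measurable.of_discrete (f := fun v : Fin n → ℤ =>
    -((∑ j, (if z j then 1 else 0) * v j : ℤ) : ℝ) / q)).comp measurable_fst)) measurable_snd

instance {n : ℕ} (q σ : ℝ) (G : Measure ℤ) [IsProbabilityMeasure G] (z : Fin n → Bool) :
    IsProbabilityMeasure (hintNoise q σ G z) :=
  Measure.isProbabilityMeasure_map (measurable_hintNoise q z).aemeasurable

lemma advClose_of_integral_eq {P Q : Measure X}
    (h : ∀ f : X → ℝ, IsDistinguisher f → ∫ x, f x ∂P = ∫ x, f x ∂Q) : AdvClose 0 P Q :=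
  fun f hf => by simp [adv, h f hf]

lemma advClose_hintNoise_succ {n : ℕ} (q σ : ℝ) (G : Measure ℤ) [IsProbabilityMeasure G]
    (z : Fin (n + 1) → Bool) : AdvClose 0 (hintNoise q σ G z)
      ((G.prod (hintNoise q σ G fun j => z j.succ)).map
        fun p => -((if z 0 then 1 else 0) * p.1 : ℝ) / q + p.2) := by
  refine advClose_of_integral_eq fun f hf => ?_
  have hm : Measurable fun p : ℤ × ℝ => -((if z 0 then 1 else 0) * p.1 : ℝ) / q + p.2 := by
    fun_prop
  rw [hintNoise, hf.integral_map (measurable_hintNoise q z),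
    (hf.comp (measurable_hintNoise q z)).integral_prod, ← map_cons_pi,
    ((hf.comp (measurable_hintNoise q z)).integral_right _).integral_map measurable_finCons,
    IsDistinguisher.integral_prod (((hf.comp (measurable_hintNoise q z)).integral_right _).comp
      measurable_finCons), hf.integral_map hm, (hf.comp hm).integral_prod]
  congr 1
  funext v₀
  have hf' : IsDistinguisher fun y : ℝ => f (-((if z 0 then 1 else 0) * v₀ : ℝ) / q + y) :=
    hf.comp (by fun_prop)
  refine Eq.trans ?_ (hf'.integral_map (measurable_hintNoise q _) _).symm
  refine Eq.trans ?_ ((hf'.comp (measurable_hintNoise q _)).integral_prod _ _).symm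
  congr 1
  funext v
  congr 1
  funext e
  congr 1
  dsimp only [Function.comp_apply]
  rw [Fin.sum_univ_succ]
  simp only [Fin.cons_zero, Fin.cons_succ]
  push_cast
  ring

lemma advClose_hintNoise {q b c σ₀ : ℝ} (hc : 0 ≤ c) (hσ₀ : 0 ≤ σ₀) (G : Measure ℤ)
    [IsProbabilityMeasure G]
    (H : ∀ σ, σ₀ ≤ σ → AdvClose c ((G.prod (contGauss σ)).map fun p => -(p.1 : ℝ) / q + p.2)
      (contGauss (Real.sqrt (σ ^ 2 + b ^ 2)))) {n : ℕ} (z : Fin n → Bool) :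
    AdvClose (n * c) (hintNoise q σ₀ G z)
      (contGauss (Real.sqrt (σ₀ ^ 2 + (∑ j, if z j then 1 else 0) * b ^ 2))) := by
  induction n with
  | zero =>
    have h : AdvClose 0 (hintNoise q σ₀ G z) (contGauss σ₀) := by
      simpa [hintNoise] using AdvClose.refl (contGauss σ₀)
    simpa [Real.sqrt_sq hσ₀] using h
  | succ n ih =>
    set w : ℝ := ∑ j : Fin n, if z j.succ then 1 else 0 with hw
    have hw0 : 0 ≤ w := Finset.sum_nonneg fun j _ => by split_ifs <;> norm_num
    have hm : Measurable fun p : ℤ × ℝ => -((if z 0 then 1 else 0) * p.1 : ℝ) / q + p.2 := by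
      fun_prop
    have h1 := (advClose_hintNoise_succ q σ₀ G z).trans
      (((AdvClose.refl G).prod (ih fun j => z j.succ)).map hm)
    have hσ : σ₀ ≤ Real.sqrt (σ₀ ^ 2 + w * b ^ 2) :=
      Real.le_sqrt_of_sq_le (by nlinarith [mul_nonneg hw0 (sq_nonneg b)])
    have h2 : AdvClose c ((G.prod (contGauss (Real.sqrt (σ₀ ^ 2 + w * b ^ 2)))).map
        fun p => -((if z 0 then 1 else 0) * p.1 : ℝ) / q + p.2)
        (contGauss (Real.sqrt (σ₀ ^ 2 + (∑ j, if z j then 1 else 0) * b ^ 2))) := by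
      rw [Fin.sum_univ_succ, ← hw]
      by_cases h0 : z 0
      · convert H _ hσ using 3
        · simp [h0]
        · rw [Real.sq_sqrt (by positivity), if_pos h0]
          ring
      · simp only [h0, Bool.false_eq_true, if_false, zero_mul, neg_zero, zero_div, zero_add]
        rw [show (fun p : ℤ × ℝ => p.2) = Prod.snd from rfl, Measure.map_snd_prod, measure_univ,
          one_smul]
        exact fun f hf => ((AdvClose.refl _) f hf).trans hc
    convert h1.trans h2 using 1
    push_cast
    ring

lemma pi_map_prod {m : ℕ} (P : Measure X) (Q : Measure Y) [IsProbabilityMeasure P]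
    [IsProbabilityMeasure Q] {g : X × Y → Z} (hg : Measurable g) :
    (Measure.pi fun _ : Fin m => (P.prod Q).map g) =
      ((Measure.pi fun _ : Fin m => P).prod (Measure.pi fun _ : Fin m => Q)).map
        fun p i => g (p.1 i, p.2 i) := by
  have : IsProbabilityMeasure ((P.prod Q).map g) :=
    Measure.isProbabilityMeasure_map hg.aemeasurable
  rw [← Measure.pi_map_pi fun _ => hg.aemeasurable,
    ← (measurePreserving_arrowProdEquivProdArrow X Y (Fin m) (fun _ => P) (fun _ => Q)).symm.map_eq,
    Measure.map_map (by fun_prop) (MeasurableEquiv.measurable _)]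
  rfl

lemma gnorm_sq {m n : ℕ} (x : Fin m → Fin n → ℤ) :
    gnorm x ^ 2 = ∑ i, ∑ j, (x i j : ℝ) ^ 2 :=
  Real.sq_sqrt (Finset.sum_nonneg fun _ _ => Finset.sum_nonneg fun _ _ => sq_nonneg _)

lemma IsDiscreteGaussian.toMeasure_eq {m n : ℕ} {dg : PMF (Fin m → Fin n → ℤ)} {r : ℝ}
    (hr : 0 < r) (h : IsDiscreteGaussian dg r) :
    dg.toMeasure = Measure.pi fun _ => Measure.pi fun _ => (intGauss r hr).toMeasure := by
  obtain ⟨K, hK, hKj⟩ := exists_intGauss_apply r hr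
  set P : Measure (Fin m → Fin n → ℤ) :=
    Measure.pi fun _ => Measure.pi fun _ => (intGauss r hr).toMeasure with hPdef
  have hexp (x : Fin m → Fin n → ℤ) : Real.exp (-Real.pi * gnorm x ^ 2 / r ^ 2) =
      ∏ i, ∏ j, Real.exp (-Real.pi / r ^ 2 * (x i j : ℝ) ^ 2) := by
    simp_rw [← Real.exp_sum, ← Finset.mul_sum, ← gnorm_sq]
    congr 1
    ring
  have hP (x : Fin m → Fin n → ℤ) : P {x} =
      ENNReal.ofReal ((K ^ n) ^ m * Real.exp (-Real.pi * gnorm x ^ 2 / r ^ 2)) := by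
    rw [hPdef, Measure.pi_singleton]
    simp_rw [Measure.pi_singleton,
      PMF.toMeasure_apply_singleton _ _ (measurableSet_singleton _), hKj, hexp]
    have hrow (i : Fin m) : ∏ j, ENNReal.ofReal (K * Real.exp (-Real.pi / r ^ 2 * (x i j : ℝ) ^ 2)) =
        ENNReal.ofReal (∏ j, K * Real.exp (-Real.pi / r ^ 2 * (x i j : ℝ) ^ 2)) :=
      (ENNReal.ofReal_prod_of_nonneg fun _ _ => by positivity).symm
    simp_rw [hrow]
    rw [← ENNReal.ofReal_prod_of_nonneg (fun _ _ => Finset.prod_nonneg fun _ _ => by positivity)]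
    simp [Finset.prod_mul_distrib]
  set a : ENNReal := ENNReal.ofReal ((dg 0).toReal / (K ^ n) ^ m) with ha
  have hdg : dg.toMeasure = a • P := by
    refine Measure.ext_of_singleton fun x => ?_
    have h0 := h x 0
    have hg0 : gnorm (0 : Fin m → Fin n → ℤ) = 0 := by simp [gnorm]
    rw [hg0] at h0
    norm_num at h0
    rw [PMF.toMeasure_apply_singleton _ _ (measurableSet_singleton _), Measure.smul_apply, hP,
      smul_eq_mul, ha, ← ENNReal.ofReal_mul (by positivity),
      ← ENNReal.ofReal_toReal (dg.apply_ne_top x), h0]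
    congr 1
    field_simp
  have h1 : a = 1 := by
    have := congrArg (fun μ => μ Set.univ) hdg
    simpa using this.symm
  rw [hdg, h1, one_smul]

/-- The leftover hash lemma for a universal family `hash` of functions `W → V` indexed by `B`. -/
lemma leftover_hash {B W V : Type*} [Fintype B] [Fintype W] [Fintype V] [Nonempty B] [Nonempty W]
    [Nonempty V] [DecidableEq V] (hash : B → W → V)
    (huniv : ∀ z z', z ≠ z' →
      Fintype.card V * (Finset.univ.filter fun A => hash A z = hash A z').card ≤ Fintype.card B)
    {δ : ℝ} (hδ : 0 ≤ δ) (hcard : (Fintype.card V : ℝ) ≤ δ ^ 2 * Fintype.card W)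
    {H : B → V → ℝ} (hH : ∀ A s, H A s ∈ Set.Icc (0 : ℝ) 1) :
    |(Fintype.card W : ℝ)⁻¹ * (∑ z, (Fintype.card B : ℝ)⁻¹ * ∑ A, H A (hash A z)) -
      (Fintype.card B : ℝ)⁻¹ * ∑ A, (Fintype.card V : ℝ)⁻¹ * ∑ s, H A s| ≤ δ := by
  classical
  set b : ℝ := (Fintype.card B : ℝ)
  set w : ℝ := (Fintype.card W : ℝ)
  set v : ℝ := (Fintype.card V : ℝ)
  have hb : 0 < b := Nat.cast_pos.2 Fintype.card_pos
  have hw : 0 < w := Nat.cast_pos.2 Fintype.card_pos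
  have hv : 0 < v := Nat.cast_pos.2 Fintype.card_pos
  let p : B → V → ℝ := fun A s => ∑ z, if hash A z = s then 1 else 0
  let D : B → V → ℝ := fun A s => p A s / w - v⁻¹
  have hp1 (A : B) : ∑ s, p A s = w := by
    simp only [p]
    rw [Finset.sum_comm]
    simp [w]
  have hp2 (A : B) : ∑ s, p A s ^ 2 = ∑ z, ∑ z', if hash A z = hash A z' then (1 : ℝ) else 0 := by
    simp only [p, sq, Finset.sum_mul_sum]
    rw [Finset.sum_comm]
    refine Finset.sum_congr rfl fun z _ => ?_
    rw [Finset.sum_comm]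
    refine Finset.sum_congr rfl fun z' _ => ?_
    simp [eq_comm]
  have hcoll (z z' : W) : ∑ A, (if hash A z = hash A z' then (1 : ℝ) else 0) ≤
      (if z = z' then b else 0) + b / v := by
    by_cases h : z = z'
    · subst h
      simp only [if_true, Finset.sum_const, Finset.card_univ, nsmul_eq_mul, mul_one]
      have : 0 ≤ b / v := by positivity
      linarith
    · rw [if_neg h, zero_add, le_div_iff₀ hv, Finset.sum_boole, mul_comm]
      have h' := huniv z z' h
      simp only [v, b]
      exact_mod_cast h'
  have hp3 : ∑ A, ∑ s, p A s ^ 2 ≤ w * b + w ^ 2 * (b / v) := by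
    simp_rw [hp2]
    rw [Finset.sum_comm]
    calc ∑ z, ∑ A, ∑ z', (if hash A z = hash A z' then (1 : ℝ) else 0)
        = ∑ z, ∑ z', ∑ A, (if hash A z = hash A z' then (1 : ℝ) else 0) :=
          Finset.sum_congr rfl fun z _ => Finset.sum_comm
      _ ≤ ∑ z, ∑ z', ((if z = z' then b else 0) + b / v) :=
          Finset.sum_le_sum fun z _ => Finset.sum_le_sum fun z' _ => hcoll z z'
      _ = w * b + w ^ 2 * (b / v) := by
          simp [Finset.sum_add_distrib, w]
          ring
  have hD : ∑ A, ∑ s, D A s ^ 2 ≤ b / w := by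
    have h1 (A : B) : ∑ s, D A s ^ 2 = (∑ s, p A s ^ 2) / w ^ 2 - v⁻¹ := by
      have h2 (s : V) : D A s ^ 2 = p A s ^ 2 / w ^ 2 - 2 / (w * v) * p A s + (v⁻¹) ^ 2 := by
        simp only [D]
        field_simp
        ring
      simp_rw [h2]
      rw [Finset.sum_add_distrib, Finset.sum_sub_distrib, ← Finset.sum_div, ← Finset.mul_sum, hp1,
        Finset.sum_const, Finset.card_univ, nsmul_eq_mul]
      change _ + v * _ = _
      field_simp
      ring
    simp_rw [h1]
    rw [Finset.sum_sub_distrib, ← Finset.sum_div, Finset.sum_const, Finset.card_univ, nsmul_eq_mul]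
    change _ - b * _ ≤ _
    have : (∑ A, ∑ s, p A s ^ 2) / w ^ 2 ≤ (w * b + w ^ 2 * (b / v)) / w ^ 2 := by gcongr
    calc _ ≤ (w * b + w ^ 2 * (b / v)) / w ^ 2 - b * v⁻¹ := by linarith
      _ = b / w := by field_simp; ring
  have heq : w⁻¹ * (∑ z, b⁻¹ * ∑ A, H A (hash A z)) - b⁻¹ * ∑ A, v⁻¹ * ∑ s, H A s =
      b⁻¹ * ∑ A, ∑ s, H A s * D A s := by
    have h1 (A : B) : ∑ s, H A s * D A s = w⁻¹ * ∑ z, H A (hash A z) - v⁻¹ * ∑ s, H A s := by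
      have h2 (s : V) : H A s * D A s =
          w⁻¹ * (∑ z, if hash A z = s then H A s else 0) - v⁻¹ * H A s := by
        have : (∑ z, if hash A z = s then H A s else 0) = H A s * p A s := by
          simp only [p, Finset.mul_sum, mul_ite, mul_one, mul_zero]
        rw [this]
        simp only [D]
        ring
      simp_rw [h2]
      rw [Finset.sum_sub_distrib, ← Finset.mul_sum, ← Finset.mul_sum, Finset.sum_comm]
      simp
    simp_rw [h1]
    rw [Finset.sum_sub_distrib, ← Finset.mul_sum, ← Finset.mul_sum, ← Finset.mul_sum,
      Finset.sum_comm]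
    ring
  rw [heq, abs_mul, abs_of_pos (inv_pos.2 hb), inv_mul_le_iff₀ hb]
  refine abs_le_of_sq_le_sq ?_ (by positivity)
  have hCS : (∑ A, ∑ s, H A s * D A s) ^ 2 ≤ (∑ A, ∑ s, H A s ^ 2) * ∑ A, ∑ s, D A s ^ 2 := by
    simp_rw [← Fintype.sum_prod_type']
    exact Finset.sum_mul_sq_le_sq_mul_sq _ _ _
  have hH2 : ∑ A, ∑ s, H A s ^ 2 ≤ b * v := by
    calc ∑ A, ∑ s, H A s ^ 2 ≤ ∑ _ : B, ∑ _ : V, (1 : ℝ) := by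
          refine Finset.sum_le_sum fun A _ => Finset.sum_le_sum fun s _ => ?_
          nlinarith [(hH A s).1, (hH A s).2]
      _ = b * v := by simp [b, v]
  calc _ ≤ _ := hCS
    _ ≤ (b * v) * (b / w) := mul_le_mul hH2 hD
        (Finset.sum_nonneg fun _ _ => Finset.sum_nonneg fun _ _ => sq_nonneg _) (by positivity)
    _ ≤ (b * (δ ^ 2 * w)) * (b / w) := by gcongr
    _ = (b * δ) ^ 2 := by field_simp

/-- The vector over `ZMod q` with the given bits. -/
def bits {n : ℕ} (q : ℕ) (z : Fin n → Bool) : Fin n → ZMod q := fun j => if z j then 1 else 0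

lemma card_mulVec_bits_eq {k n q : ℕ} [NeZero q] {z z' : Fin n → Bool} (h : z ≠ z') :
    Fintype.card (Fin k → ZMod q) * (Finset.univ.filter fun A : Matrix (Fin k) (Fin n) (ZMod q) =>
      A.mulVec (bits q z) = A.mulVec (bits q z')).card =
      Fintype.card (Matrix (Fin k) (Fin n) (ZMod q)) := by
  obtain ⟨j, hj⟩ := Function.ne_iff.1 h
  let φ : Matrix (Fin k) (Fin n) (ZMod q) →+ (Fin k → ZMod q) :=
    AddMonoidHom.mk' (fun A => A.mulVec (bits q z - bits q z')) fun A A' => Matrix.add_mulVec _ _ _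
  obtain ⟨u, hu⟩ : ∃ u : ZMod q, (bits q z - bits q z') j * u = 1 := by
    rcases Bool.eq_false_or_eq_true (z j) with h1 | h1 <;>
      rcases Bool.eq_false_or_eq_true (z' j) with h2 | h2
    · exact absurd (h1.trans h2.symm) hj
    · exact ⟨1, by simp [bits, h1, h2]⟩
    · exact ⟨-1, by simp [bits, h1, h2]⟩
    · exact absurd (h1.trans h2.symm) hj
  have hsurj : Function.Surjective φ := fun s => by
    refine ⟨Matrix.of fun i j' => if j' = j then s i * u else 0, ?_⟩
    funext i
    simp only [φ, AddMonoidHom.mk'_apply, Matrix.mulVec, dotProduct, Matrix.of_apply, ite_mul,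
      zero_mul, Finset.sum_ite_eq', Finset.mem_univ, if_true]
    rw [mul_assoc, mul_comm u, hu, mul_one]
  have hfib (s : Fin k → ZMod q) : (Finset.univ.filter fun A => φ A = s).card =
      (Finset.univ.filter fun A => φ A = 0).card :=
    AddMonoidHom.card_fiber_eq_of_mem_range φ (hsurj s) (hsurj 0)
  have hset : (Finset.univ.filter fun A : Matrix (Fin k) (Fin n) (ZMod q) =>
      A.mulVec (bits q z) = A.mulVec (bits q z')) = Finset.univ.filter fun A => φ A = 0 := by
    refine Finset.filter_congr fun A _ => ?_
    simp [φ, Matrix.mulVec_sub, sub_eq_zero]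
  have hsum := Finset.card_eq_sum_card_fiberwise
    (s := (Finset.univ : Finset (Matrix (Fin k) (Fin n) (ZMod q)))) (f := φ) (t := Finset.univ)
    (by simp)
  rw [Finset.sum_congr rfl fun s _ => hfib s, Finset.sum_const, Finset.card_univ, Finset.card_univ,
    smul_eq_mul] at hsum
  rw [hset, hsum]

lemma pow_le_of_logb_le {k n q : ℕ} [NeZero q] {δ : ℝ} (hδ : 0 < δ)
    (hdim : (k : ℝ) * Real.logb 2 q + 2 * Real.logb 2 (1 / δ) ≤ (n : ℝ)) :
    (q : ℝ) ^ k ≤ δ ^ 2 * 2 ^ n := by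
  have hq : (0 : ℝ) < q := Nat.cast_pos.2 (NeZero.pos q)
  have h1 : Real.logb 2 ((q : ℝ) ^ k * (1 / δ) ^ 2) ≤ n := by
    rw [Real.logb_mul (by positivity) (by positivity), Real.logb_pow, Real.logb_pow]
    exact_mod_cast hdim
  rw [Real.logb_le_iff_le_rpow (by norm_num) (by positivity), Real.rpow_natCast] at h1
  calc (q : ℝ) ^ k = δ ^ 2 * ((q : ℝ) ^ k * (1 / δ) ^ 2) := by field_simp
    _ ≤ _ := by gcongr

lemma integral_uniformOfFintype {X : Type*} [MeasurableSpace X] [MeasurableSingletonClass X]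
    [Fintype X] [Nonempty X] (f : X → ℝ) :
    ∫ x, f x ∂(PMF.uniformOfFintype X).toMeasure = (Fintype.card X : ℝ)⁻¹ * ∑ x, f x := by
  rw [PMF.integral_eq_sum, Finset.mul_sum]
  simp

instance {k n q : ℕ} : MeasurableSingletonClass (Matrix (Fin k) (Fin n) (ZMod q)) :=
  inferInstanceAs (MeasurableSingletonClass (Fin k → Fin n → ZMod q))

instance {k n q : ℕ} [NeZero q] : Countable (Matrix (Fin k) (Fin n) (ZMod q)) :=
  inferInstanceAs (Countable (Fin k → Fin n → ZMod q))

lemma abs_integral_mulVec_bits_sub_le {k n q : ℕ} [NeZero q] {δ : ℝ} (hδ : 0 < δ)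
    (hdim : (k : ℝ) * Real.logb 2 q + 2 * Real.logb 2 (1 / δ) ≤ (n : ℝ))
    {H : Matrix (Fin k) (Fin n) (ZMod q) → (Fin k → ZMod q) → ℝ}
    (hH : ∀ A s, H A s ∈ Set.Icc (0 : ℝ) 1) :
    |(∫ z, ∫ A, H A (A.mulVec (bits q z))
        ∂(PMF.uniformOfFintype (Matrix (Fin k) (Fin n) (ZMod q))).toMeasure
        ∂(PMF.uniformOfFintype (Fin n → Bool)).toMeasure) -
      ∫ A, ∫ s, H A s ∂(PMF.uniformOfFintype (Fin k → ZMod q)).toMeasure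
        ∂(PMF.uniformOfFintype (Matrix (Fin k) (Fin n) (ZMod q))).toMeasure| ≤ δ := by
  have h := leftover_hash
    (fun (A : Matrix (Fin k) (Fin n) (ZMod q)) (z : Fin n → Bool) => A.mulVec (bits q z))
    (fun z z' h => (card_mulVec_bits_eq h).le) hδ.le
    (by simpa using pow_le_of_logb_le hδ hdim) hH
  simp_rw [integral_uniformOfFintype]
  exact h

instance : IsProbabilityMeasure uniT := ⟨by simp [uniT]⟩

/-- The uniform distribution on a finite type. -/
abbrev unif (X : Type*) [Fintype X] [Nonempty X] [MeasurableSpace X] : Measure X :=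
  (PMF.uniformOfFintype X).toMeasure

lemma pi_unif {m : ℕ} [Fintype X] [Nonempty X] [MeasurableSingletonClass X] :
    (Measure.pi fun _ : Fin m => unif X) = unif (Fin m → X) := by
  refine Measure.ext_of_singleton fun x => ?_
  rw [Measure.pi_singleton, PMF.toMeasure_apply_singleton _ _ (.singleton x)]
  simp_rw [fun i => PMF.toMeasure_apply_singleton (PMF.uniformOfFintype X) (x i) (.singleton _)]
  simp [ENNReal.inv_pow]

lemma measurable_lweMap (n q : ℕ) [NeZero q] (s : Fin n → ZMod q) :
    Measurable fun ae : (Fin n → ZMod q) × ℝ =>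
      ((ae.1, toT (∑ j, ae.1 j * s j) + ((ae.2 : ℝ) : 𝕋)) : Samp n q) :=
  measurable_fst.prodMk <| Measurable.add
    ((Measurable.of_discrete (f := fun a : Fin n → ZMod q => toT (∑ j, a j * s j))).comp
      measurable_fst) (AddCircle.measurable_mk'.comp measurable_snd)

instance (n q : ℕ) [NeZero q] (s : Fin n → ZMod q) (φ : Measure ℝ) [IsProbabilityMeasure φ] :
    IsProbabilityMeasure (lweA n q s φ) :=
  Measure.isProbabilityMeasure_map (measurable_lweMap n q s).aemeasurable

instance (n m q : ℕ) [NeZero q] (s : Fin n → ZMod q) (φ : Measure ℝ) [IsProbabilityMeasure φ] :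
    IsProbabilityMeasure (lweSamples n m q s φ) := by
  unfold lweSamples; infer_instance

instance (n q : ℕ) [NeZero q] : IsProbabilityMeasure (uniSamp n q) := by
  unfold uniSamp; infer_instance

instance (n m q : ℕ) [NeZero q] : IsProbabilityMeasure (uniSamples n m q) := by
  unfold uniSamples; infer_instance

instance (k m q : ℕ) [NeZero q] (γ : ℝ) : IsProbabilityMeasure (stdLWESamples k m q γ) :=
  isProbabilityMeasure_bind Measurable.of_discrete.aemeasurable
    (.of_forall fun _ => inferInstance)

lemma AdvClose.lweSamples {c : ℝ} {φ ψ : Measure ℝ} [IsProbabilityMeasure φ]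
    [IsProbabilityMeasure ψ] (h : AdvClose c φ ψ) (n m q : ℕ) [NeZero q] (s : Fin n → ZMod q) :
    AdvClose (m * c) (lweSamples n m q s φ) (lweSamples n m q s ψ) := by
  refine AdvClose.pi ?_ m
  simpa [lweA] using ((AdvClose.refl _).prod h).map (measurable_lweMap n q s)

lemma IsDistinguisher.integral_lweSamples {n m q : ℕ} [NeZero q] {f : (Fin m → Samp n q) → ℝ}
    (hf : IsDistinguisher f) (s : Fin n → ZMod q) (φ : Measure ℝ) [IsProbabilityMeasure φ] :
    ∫ x, f x ∂(lweSamples n m q s φ) =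
      ∫ a, ∫ e, f (fun i => (a i, toT (∑ j, a i j * s j) + ((e i : ℝ) : 𝕋)))
        ∂(Measure.pi fun _ => φ) ∂(unif (Fin m → Fin n → ZMod q)) := by
  have hg : Measurable fun (p : (Fin m → Fin n → ZMod q) × (Fin m → ℝ)) (i : Fin m) =>
      ((p.1 i, toT (∑ j, p.1 i j * s j) + ((p.2 i : ℝ) : 𝕋)) : Samp n q) :=
    measurable_pi_lambda _ fun i => (measurable_lweMap n q s).comp
      (f := fun p : (Fin m → Fin n → ZMod q) × (Fin m → ℝ) => (p.1 i, p.2 i)) (by fun_prop)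
  unfold LWEPaper.lweSamples lweA
  rw [pi_map_prod _ _ (measurable_lweMap n q s), hf.integral_map hg, (hf.comp hg).integral_prod,
    pi_unif]

lemma IsDistinguisher.integral_uniSamples {n m q : ℕ} [NeZero q] {f : (Fin m → Samp n q) → ℝ}
    (hf : IsDistinguisher f) :
    ∫ x, f x ∂(uniSamples n m q) =
      ∫ a, ∫ y, f (fun i => (a i, y i)) ∂(Measure.pi fun _ => uniT)
        ∂(unif (Fin m → Fin n → ZMod q)) := by
  have hg : Measurable fun (p : (Fin m → Fin n → ZMod q) × (Fin m → 𝕋)) (i : Fin m) =>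
      ((p.1 i, p.2 i) : Samp n q) := by fun_prop
  have h := pi_map_prod (m := m) (unif (Fin n → ZMod q)) uniT (g := id) measurable_id
  rw [Measure.map_id] at h
  unfold uniSamples uniSamp
  rw [h]
  simp only [id]
  rw [hf.integral_map hg, (hf.comp hg).integral_prod, pi_unif]

lemma IsDistinguisher.integral_pmf_bind {f : Y → ℝ} (hf : IsDistinguisher f)
    [DiscreteMeasurableSpace X] [Countable X] (p : PMF X) (κ : X → PMF Y) :
    ∫ y, f y ∂(p.bind κ).toMeasure = ∫ x, ∫ y, f y ∂(κ x).toMeasure ∂p.toMeasure := by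
  have h : (p.bind κ).toMeasure = p.toMeasure.bind fun x => (κ x).toMeasure := by
    ext s hs
    rw [PMF.toMeasure_bind_apply _ _ _ hs, Measure.bind_apply hs Measurable.of_discrete.aemeasurable,
      lintegral_countable']
    exact tsum_congr fun x => by
      rw [PMF.toMeasure_apply_singleton _ _ (.singleton x), mul_comm]
  rw [h, hf.integral_bind _ Measurable.of_discrete]

lemma integral_pmf_pure [MeasurableSingletonClass X] (f : X → ℝ) (x : X) :
    ∫ y, f y ∂(PMF.pure x).toMeasure = f x := by
  rw [PMF.toMeasure_pure, integral_dirac]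

section extLWE

variable {k n m q : ℕ} [NeZero q]
  {g : Matrix (Fin k) (Fin n) (ZMod q) × (Fin m → Fin n → ZMod q) × (Fin m → ℤ) → ℝ}

lemma IsDistinguisher.integral_extLWEm₀ (hg : IsDistinguisher g) (dgm : PMF (Fin m → Fin n → ℤ))
    (z : Fin n → ℤ) : ∫ x, g x ∂(extLWEm₀ k n m q dgm z) =
      ∫ A, ∫ S, ∫ E, g (A, fun i j => A.transpose.mulVec (S i) j + ((E i j : ℤ) : ZMod q),
          fun i => ∑ j, z j * E i j) ∂dgm.toMeasure ∂(unif (Fin m → Fin k → ZMod q))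
        ∂(unif (Matrix (Fin k) (Fin n) (ZMod q))) := by
  unfold extLWEm₀
  simp_rw [hg.integral_pmf_bind, integral_pmf_pure]

lemma IsDistinguisher.integral_extLWEm₁ (hg : IsDistinguisher g) (dgm : PMF (Fin m → Fin n → ℤ))
    (z : Fin n → ℤ) : ∫ x, g x ∂(extLWEm₁ k n m q dgm z) =
      ∫ A, ∫ B, ∫ E, g (A, B, fun i => ∑ j, z j * E i j) ∂dgm.toMeasure
        ∂(unif (Fin m → Fin n → ZMod q)) ∂(unif (Matrix (Fin k) (Fin n) (ZMod q))) := by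
  unfold extLWEm₁
  simp_rw [hg.integral_pmf_bind, integral_pmf_pure]

end extLWE

lemma toT_intCast {q : ℕ} [NeZero q] (x : ℤ) : toT (x : ZMod q) = ((x / q : ℝ) : 𝕋) :=
  ZMod.toAddCircle_intCast x

section reduction

variable {k n m q : ℕ} [NeZero q]

/-- The integer vector with the given bits. -/
def intBits (z : Fin n → Bool) : Fin n → ℤ := fun j => if z j then 1 else 0

/-- The samples, with `n`-dimensional public part `B` and secret `bits q z`, obtained from the
hints `h` by adding the noise `e`. -/
def hintSamples (z : Fin n → Bool) (B : Fin m → Fin n → ZMod q) (h : Fin m → ℤ) (e : Fin m → ℝ) :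
    Fin m → Samp n q :=
  fun i => (B i, toT (∑ j, B i j * bits q z j) + ((-(h i : ℝ) / q + e i : ℝ) : 𝕋))

lemma measurable_hintSamples (z : Fin n → Bool) :
    Measurable fun p : ((Fin m → Fin n → ZMod q) × (Fin m → ℤ)) × (Fin m → ℝ) =>
      hintSamples z p.1.1 p.1.2 p.2 := by
  refine measurable_from_prod_countable_right fun x => measurable_pi_lambda _ fun i => ?_
  refine Measurable.prodMk (measurable_const (a := x.1 i)) ?_
  exact (measurable_const (a := toT (∑ j, x.1 i j * bits q z j))).add
    (AddCircle.measurable_mk'.comp (f := fun e : Fin m → ℝ => -(x.2 i : ℝ) / q + e i) (by fun_prop))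

/-- The `n`-dimensional samples obtained from the `k`-dimensional samples `x` by applying
`a ↦ Aᵀ a + e` to the public parts. -/
def liftSamples (A : Matrix (Fin k) (Fin n) (ZMod q)) (E : Fin m → Fin n → ℤ)
    (x : Fin m → Samp k q) : Fin m → Samp n q :=
  fun i => (fun j => A.transpose.mulVec (x i).1 j + ((E i j : ℤ) : ZMod q), (x i).2)

lemma measurable_liftSamples :
    Measurable fun p : (Matrix (Fin k) (Fin n) (ZMod q) × (Fin m → Fin n → ℤ)) ×
      (Fin m → Samp k q) => liftSamples p.1.1 p.1.2 p.2 := by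
  refine measurable_from_prod_countable_right fun x => measurable_pi_lambda _ fun i => ?_
  refine Measurable.prodMk ?_ (by fun_prop)
  exact (Measurable.of_discrete (f := fun a : Fin k → ZMod q =>
    fun j => x.1.transpose.mulVec a j + ((x.2 i j : ℤ) : ZMod q))).comp (by fun_prop)

variable (f : (Fin m → Samp n q) → ℝ)

/-- The extended LWE distinguisher with hint vector `intBits z` that runs `f` on samples with
secret `bits q z`. -/
def hintDistinguisher (γ : ℝ) (z : Fin n → Bool) :
    Matrix (Fin k) (Fin n) (ZMod q) × (Fin m → Fin n → ZMod q) × (Fin m → ℤ) → ℝ :=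
  fun x => ∫ e, f (hintSamples z x.2.1 x.2.2 e) ∂(Measure.pi fun _ => contGauss γ)

/-- The LWE distinguisher that lifts the samples to dimension `n`. -/
def liftDistinguisher (k : ℕ) (dgm : PMF (Fin m → Fin n → ℤ)) : (Fin m → Samp k q) → ℝ :=
  fun x => ∫ p, f (liftSamples p.1 p.2 x)
    ∂((unif (Matrix (Fin k) (Fin n) (ZMod q))).prod dgm.toMeasure)

/-- The extended LWE distinguisher that ignores the hints and adds uniform second components. -/
def uniDistinguisher :
    Matrix (Fin k) (Fin n) (ZMod q) × (Fin m → Fin n → ZMod q) × (Fin m → ℤ) → ℝ :=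
  fun x => ∫ y, f (fun i => (x.2.1 i, y i)) ∂(Measure.pi fun _ => uniT)

variable {f} (hf : IsDistinguisher f)
include hf

lemma isDistinguisher_hintDistinguisher (γ : ℝ) (z : Fin n → Bool) :
    IsDistinguisher (hintDistinguisher (k := k) f γ z) :=
  ((hf.comp (measurable_hintSamples z)).integral_right _).comp
    (X := Matrix (Fin k) (Fin n) (ZMod q) × (Fin m → Fin n → ZMod q) × (Fin m → ℤ)) measurable_snd

lemma isDistinguisher_liftDistinguisher (dgm : PMF (Fin m → Fin n → ℤ)) :
    IsDistinguisher (liftDistinguisher f k dgm) :=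
  (hf.comp measurable_liftSamples).integral_left _

omit [NeZero q] in
lemma isDistinguisher_uniDistinguisher : IsDistinguisher (uniDistinguisher (k := k) f) :=
  (hf.comp (X := (Fin m → Fin n → ZMod q) × (Fin m → 𝕋)) (g := fun p i => (p.1 i, p.2 i))
    (by fun_prop)).integral_right _ |>.comp
    (X := Matrix (Fin k) (Fin n) (ZMod q) × (Fin m → Fin n → ZMod q) × (Fin m → ℤ))
    (g := fun x => x.2.1) (by fun_prop)

lemma integral_hintDistinguisher_extLWEm₁ {γ : ℝ} (z : Fin n → Bool) {G : Measure ℤ}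
    [IsProbabilityMeasure G] {dgm : PMF (Fin m → Fin n → ℤ)}
    (hdgm : dgm.toMeasure = Measure.pi fun _ => Measure.pi fun _ => G) :
    ∫ x, hintDistinguisher f γ z x ∂(extLWEm₁ k n m q dgm (intBits z)) =
      ∫ x, f x ∂(lweSamples n m q (bits q z) (hintNoise q γ G z)) := by
  rw [(isDistinguisher_hintDistinguisher hf γ z).integral_extLWEm₁]
  simp only [hintDistinguisher]
  rw [integral_const, probReal_univ, one_smul]
  rw [hf.integral_lweSamples]
  refine integral_congr_ae (.of_forall fun B => ?_)
  have hm : Measurable fun e : Fin m → ℝ => fun i =>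
      ((B i, toT (∑ j, B i j * bits q z j) + ((e i : ℝ) : 𝕋)) : Samp n q) :=
    measurable_pi_lambda _ fun i => measurable_const.prodMk
      (measurable_const.add (AddCircle.measurable_mk'.comp (measurable_pi_apply i)))
  have hm' : Measurable fun (p : (Fin m → Fin n → ℤ) × (Fin m → ℝ)) (i : Fin m) =>
      -((∑ j, (if z j then 1 else 0) * p.1 i j : ℤ) : ℝ) / q + p.2 i :=
    measurable_pi_lambda _ fun i => (measurable_hintNoise q z).comp
      (f := fun p : (Fin m → Fin n → ℤ) × (Fin m → ℝ) => (p.1 i, p.2 i)) (by fun_prop)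
  simp only [hdgm]
  unfold hintNoise
  rw [pi_map_prod _ _ (measurable_hintNoise q z), (hf.comp hm).integral_map hm',
    ((hf.comp hm).comp hm').integral_prod]
  rfl

lemma integral_hintDistinguisher_extLWEm₀ {γ : ℝ} (z : Fin n → Bool)
    (dgm : PMF (Fin m → Fin n → ℤ)) :
    ∫ x, hintDistinguisher f γ z x ∂(extLWEm₀ k n m q dgm (intBits z)) =
      ∫ A, (∫ E, ∫ x, f (liftSamples A E x)
        ∂(lweSamples k m q (A.mulVec (bits q z)) (contGauss γ)) ∂dgm.toMeasure)
        ∂(unif (Matrix (Fin k) (Fin n) (ZMod q))) := by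
  rw [(isDistinguisher_hintDistinguisher hf γ z).integral_extLWEm₀]
  refine integral_congr_ae (.of_forall fun A => ?_)
  have hA (E : Fin m → Fin n → ℤ) : IsDistinguisher fun x => f (liftSamples A E x) :=
    hf.comp (measurable_liftSamples.comp (f := fun x => ((A, E), x)) (by fun_prop))
  have key (S : Fin m → Fin k → ZMod q) (E : Fin m → Fin n → ℤ) (e : Fin m → ℝ) :
      hintSamples z (fun i j => A.transpose.mulVec (S i) j + ((E i j : ℤ) : ZMod q))
        (fun i => ∑ j, intBits z j * E i j) e =
      liftSamples A E fun i => (S i, toT (∑ l, S i l * A.mulVec (bits q z) l) + ((e i : ℝ) : 𝕋)) := by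
    funext i
    refine Prod.ext rfl ?_
    simp only [hintSamples, liftSamples]
    have h1 : ∑ j, (A.transpose.mulVec (S i) j + ((E i j : ℤ) : ZMod q)) * bits q z j =
        (∑ l, S i l * A.mulVec (bits q z) l) + ((∑ j, intBits z j * E i j : ℤ) : ZMod q) := by
      simp only [add_mul, Finset.sum_add_distrib]
      congr 1
      · have := Matrix.dotProduct_mulVec (S i) A (bits q z)
        rw [← Matrix.mulVec_transpose] at this
        exact this.symm
      · push_cast
        exact Finset.sum_congr rfl fun j _ => by simp [bits, intBits, mul_comm]
    have h2 (x y : ZMod q) : toT (x + y) = toT x + toT y := map_add ZMod.toAddCircle x y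
    rw [h1, h2, toT_intCast, add_assoc, ← AddCircle.coe_add]
    congr 3
    ring
  simp only [hintDistinguisher, key]
  have hd : IsDistinguisher fun p : (Fin m → Fin k → ZMod q) × (Fin m → Fin n → ℤ) =>
      ∫ e, f (liftSamples A p.2 fun i =>
        (p.1 i, toT (∑ l, p.1 i l * A.mulVec (bits q z) l) + ((e i : ℝ) : 𝕋)))
        ∂(Measure.pi fun _ => contGauss γ) :=
    ⟨.of_discrete, fun p => ((hA p.2).comp (measurable_pi_lambda _ fun i =>
      measurable_const.prodMk (measurable_const.add
        (AddCircle.measurable_mk'.comp (measurable_pi_apply i))))).integral_mem _⟩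
  rw [hd.integral_swap]
  exact integral_congr_ae (.of_forall fun E => ((hA E).integral_lweSamples _ _).symm)

lemma integral_liftDistinguisher_stdLWESamples {γ : ℝ} (dgm : PMF (Fin m → Fin n → ℤ)) :
    ∫ x, liftDistinguisher f k dgm x ∂(stdLWESamples k m q γ) =
      ∫ A, ∫ s, (∫ E, ∫ x, f (liftSamples A E x) ∂(lweSamples k m q s (contGauss γ))
        ∂dgm.toMeasure) ∂(unif (Fin k → ZMod q)) ∂(unif (Matrix (Fin k) (Fin n) (ZMod q))) := by
  unfold liftDistinguisher
  have hd := hf.comp (measurable_liftSamples (k := k))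
  have hd' := hd.integral_right (stdLWESamples k m q γ)
  rw [← hd.integral_swap, hd'.integral_prod]
  refine integral_congr_ae (.of_forall fun A => ?_)
  have h2 : IsDistinguisher fun p : (Fin k → ZMod q) × (Fin m → Fin n → ℤ) =>
      ∫ x, f (liftSamples A p.2 x) ∂(lweSamples k m q p.1 (contGauss γ)) :=
    ⟨.of_discrete, fun p => (hd.comp (measurable_prodMk_left (x := (A, p.2)))).integral_mem _⟩
  dsimp only
  rw [h2.integral_swap]
  refine integral_congr_ae (.of_forall fun E => ?_)
  exact (hd.comp (measurable_prodMk_left (x := (A, E)))).integral_bind _ .of_discrete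

lemma integral_liftDistinguisher_uniSamples (dgm : PMF (Fin m → Fin n → ℤ)) :
    ∫ x, liftDistinguisher f k dgm x ∂(uniSamples k m q) =
      ∫ x, uniDistinguisher f x ∂(extLWEm₀ k n m q dgm 0) := by
  unfold liftDistinguisher
  have hd := hf.comp (measurable_liftSamples (k := k))
  rw [← hd.integral_swap, (hd.integral_right _).integral_prod,
    (isDistinguisher_uniDistinguisher hf).integral_extLWEm₀]
  refine integral_congr_ae (.of_forall fun A => ?_)
  have h2 : IsDistinguisher fun p : (Fin m → Fin k → ZMod q) × (Fin m → Fin n → ℤ) =>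
      ∫ y, f (liftSamples A p.2 fun i => (p.1 i, y i)) ∂(Measure.pi fun _ => uniT) :=
    ⟨.of_discrete, fun p => ((hd.comp (measurable_prodMk_left (x := (A, p.2)))).comp
      (g := fun (y : Fin m → 𝕋) i => (p.1 i, y i)) (by fun_prop)).integral_mem _⟩
  refine Eq.trans ?_ (h2.integral_swap _ _).symm
  refine integral_congr_ae (.of_forall fun E => ?_)
  exact (hd.comp (measurable_prodMk_left (x := (A, E)))).integral_uniSamples

lemma integral_uniDistinguisher_extLWEm₁ (dgm : PMF (Fin m → Fin n → ℤ)) :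
    ∫ x, uniDistinguisher f x ∂(extLWEm₁ k n m q dgm 0) = ∫ x, f x ∂(uniSamples n m q) := by
  rw [(isDistinguisher_uniDistinguisher hf).integral_extLWEm₁, hf.integral_uniSamples]
  simp [uniDistinguisher]

end reduction

lemma advClose_intGauss_of_smoothing {n q : ℕ} [NeZero q] (hn : 1 ≤ n) {ε β σ : ℝ} (hε : 0 < ε)
    (hε' : ε < 1 / 2)
    (hβ : Real.sqrt (2 * Real.log (2 * n * (1 + 1 / ε)) / Real.pi) / q ≤ β) (hβ0 : 0 < β)
    (hr : 0 < (q : ℝ) * β) (hσ : β ≤ σ) :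
    AdvClose (4 * (ε / n))
      (((intGauss (q * β) hr).toMeasure.prod (contGauss σ)).map fun p => -(p.1 : ℝ) / q + p.2)
      (contGauss (Real.sqrt (σ ^ 2 + β ^ 2))) := by
  have hq : (0 : ℝ) < q := Nat.cast_pos.2 (NeZero.pos q)
  have hn' : (1 : ℝ) ≤ n := by exact_mod_cast hn
  have hσ0 : 0 < σ := hβ0.trans_le hσ
  set L : ℝ := 2 * n * (1 + 1 / ε) with hL
  have hL0 : 0 < L := by positivity
  have h1 : Real.log L ≤ Real.pi * ((q * β) ^ 2 / 2) := by
    rw [div_le_iff₀ hq, mul_comm, Real.sqrt_le_iff] at hβ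
    have := hβ.2
    rw [div_le_iff₀ Real.pi_pos] at this
    linarith
  have h2 : (q * β) ^ 2 / 2 ≤ (q * β) ^ 2 * (q * σ) ^ 2 / ((q * β) ^ 2 + (q * σ) ^ 2) := by
    rw [div_le_div_iff₀ two_pos (by positivity), mul_assoc]
    have : (q * β) ^ 2 ≤ (q * σ) ^ 2 := by gcongr
    exact mul_le_mul_of_nonneg_left (by linarith) (by positivity)
  have h3 : Real.exp (-Real.pi * ((q * β) ^ 2 * (q * σ) ^ 2 / ((q * β) ^ 2 + (q * σ) ^ 2))) ≤
      L⁻¹ := by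
    rw [← Real.exp_log hL0, ← Real.exp_neg]
    refine Real.exp_le_exp.2 ?_
    have := mul_le_mul_of_nonneg_left h2 Real.pi_pos.le
    linarith
  have h4 : L⁻¹ = ε / (2 * n * (1 + ε)) := by
    rw [hL]
    field_simp
    ring
  have h5 : L⁻¹ * (2 + ε / n) ≤ ε / n := by
    have : ε / n ≤ ε := div_le_self hε.le hn'
    calc L⁻¹ * (2 + ε / n) ≤ L⁻¹ * (2 + 2 * ε) := by gcongr; linarith
      _ = ε / n := by rw [h4]; field_simp
  have h6 : L⁻¹ < 1 := by
    have : 0 < ε / n := by positivity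
    nlinarith [inv_pos.2 hL0, div_le_self hε.le hn']
  have h := advClose_intGauss_add_contGauss (q := q) (e := ε / n) hq hr hσ0
    ((div_le_self hε.le hn').trans hε'.le) (by
      rw [div_le_iff₀ (by linarith)]
      have := mul_le_mul_of_nonneg_right h3 (show 0 ≤ 2 + ε / n by positivity)
      linarith)
  rwa [mul_div_cancel_left₀ _ hq.ne'] at h

lemma abs_integral_unif_sub_le [Fintype X] [Nonempty X] [MeasurableSingletonClass X]
    {u v : X → ℝ} {c : ℝ} (h : ∀ x, |u x - v x| ≤ c) :
    |(∫ x, u x ∂(unif X)) - ∫ x, v x ∂(unif X)| ≤ c := by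
  rw [← integral_sub .of_finite .of_finite]
  simpa using norm_integral_le_of_norm_le_const (μ := unif X) (f := fun x => u x - v x)
    (.of_forall h)

end

/-- **Lemma 4.8 (reduction to binary secret).** Let `k, n, m, q ≥ 1`, `ε ∈ (0,1/2)` and
`δ, α, β, γ > 0` with `n ≥ k·log₂ q + 2·log₂(1/δ)`, `β ≥ √(2·ln(2n(1+1/ε))/π)/q`,
`α = √(2n)·β` and `γ = √n·β`.  For every adversary `f` against `binLWE_{n,m,q,≤α}` with
advantage `ζ` (i.e., with advantage at least `ζ` for every noise function bounded by `α`)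
there exist adversaries `B₁` for `extLWE^m_{k,n,q,β,{0,1}ⁿ}` (a hint vector
`z₁ ∈ {0,1}ⁿ` together with a distinguisher `g₁`), `B₂ = g₂` for `LWE_{k,m,q,γ}` and `B₃`
for `extLWE^m_{k,n,q,β,{0ⁿ}}` (a distinguisher `g₃`, hint vector `0`), such that
`Adv[f] ≤ Adv[B₁] + Adv[B₂] + Adv[B₃] + 4mε + δ`. -/
theorem binary_secret_reduction (k n m q : ℕ) [NeZero q]
    (hk : 1 ≤ k) (hn : 1 ≤ n) (hm : 1 ≤ m) (hq : 1 ≤ q)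
    (ε δ α β γ : ℝ) (hε : 0 < ε) (hε' : ε < 1 / 2) (hδ : 0 < δ)
    (hdim : (k : ℝ) * Real.logb 2 q + 2 * Real.logb 2 (1 / δ) ≤ (n : ℝ))
    (hβ : Real.sqrt (2 * Real.log (2 * n * (1 + 1 / ε)) / Real.pi) / q ≤ β) (hβ0 : 0 < β)
    (hα : α = Real.sqrt (2 * n) * β) (hγ : γ = Real.sqrt n * β)
    (dgm : PMF (Fin m → Fin n → ℤ))
    (hdgm : IsDiscreteGaussian dgm ((q : ℝ) * β)) :
    ∀ f : (Fin m → Samp n q) → ℝ, IsDistinguisher f → ∀ ζ : ℝ,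
      (∀ αf : (Fin n → Bool) → ℝ, (∀ z, 0 ≤ αf z ∧ αf z ≤ α) →
        ζ ≤ adv f (binLWESamples n m q αf) (uniSamples n m q)) →
      ∃ (z₁ : Fin n → ℤ) (_ : ∀ i, z₁ i = 0 ∨ z₁ i = 1)
        (g₁ : (Matrix (Fin k) (Fin n) (ZMod q) × (Fin m → Fin n → ZMod q) × (Fin m → ℤ)) → ℝ)
        (_ : IsDistinguisher g₁)
        (g₂ : (Fin m → Samp k q) → ℝ) (_ : IsDistinguisher g₂)
        (g₃ : (Matrix (Fin k) (Fin n) (ZMod q) × (Fin m → Fin n → ZMod q) × (Fin m → ℤ)) → ℝ)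
        (_ : IsDistinguisher g₃),
        ζ ≤ adv g₁ (extLWEm₀ k n m q dgm z₁) (extLWEm₁ k n m q dgm z₁)
            + adv g₂ (stdLWESamples k m q γ) (uniSamples k m q)
            + adv g₃ (extLWEm₀ k n m q dgm 0) (extLWEm₁ k n m q dgm 0)
            + 4 * m * ε + δ := by
  intro f hf ζ hζ
  have hq0 : (0 : ℝ) < q := Nat.cast_pos.2 (NeZero.pos q)
  have hn' : (1 : ℝ) ≤ n := by exact_mod_cast hn
  have hr : 0 < (q : ℝ) * β := by positivity
  have hβγ : β ≤ γ := hγ ▸ le_mul_of_one_le_left hβ0.le (Real.one_le_sqrt.2 hn')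
  have hdg := hdgm.toMeasure_eq hr
  let αf : (Fin n → Bool) → ℝ := fun z =>
    Real.sqrt (γ ^ 2 + (∑ j, if z j then 1 else 0) * β ^ 2)
  have hαf (z : Fin n → Bool) : 0 ≤ αf z ∧ αf z ≤ α := by
    refine ⟨Real.sqrt_nonneg _, Real.sqrt_le_iff.2 ⟨by rw [hα]; positivity, ?_⟩⟩
    have hw : (∑ j, if z j then (1 : ℝ) else 0) ≤ n := by
      calc (∑ j, if z j then (1 : ℝ) else 0) ≤ ∑ _ : Fin n, 1 :=
            Finset.sum_le_sum fun j _ => by split_ifs <;> norm_num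
        _ = n := by simp
    rw [hα, hγ, mul_pow, mul_pow, Real.sq_sqrt (by positivity), Real.sq_sqrt (by positivity)]
    nlinarith [mul_le_mul_of_nonneg_right hw (sq_nonneg β)]
  have hnoise (z : Fin n → Bool) :
      |(∫ x, f x ∂(lweSamples n m q (bits q z) (contGauss (αf z)))) -
        ∫ x, hintDistinguisher f γ z x ∂(extLWEm₁ k n m q dgm (intBits z))| ≤ 4 * m * ε := by
    rw [integral_hintDistinguisher_extLWEm₁ hf z hdg, abs_sub_comm]
    have h := (advClose_hintNoise (by positivity) (hβ0.le.trans hβγ) _ (fun σ hσ =>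
      advClose_intGauss_of_smoothing hn hε hε' hβ hβ0 hr (hβγ.trans hσ)) z).lweSamples n m q
      (bits q z) f hf
    have hcoeff : (m : ℝ) * (n * (4 * (ε / n))) = 4 * m * ε := by field_simp
    exact h.trans_eq hcoeff
  obtain ⟨z₁, hz₁⟩ := Finite.exists_max fun z : Fin n → Bool =>
    adv (hintDistinguisher (k := k) f γ z) (extLWEm₀ k n m q dgm (intBits z))
      (extLWEm₁ k n m q dgm (intBits z))
  refine ⟨intBits z₁, fun i => by by_cases h : z₁ i <;> simp [intBits, h],
    _, isDistinguisher_hintDistinguisher hf γ z₁, _, isDistinguisher_liftDistinguisher hf dgm,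
    _, isDistinguisher_uniDistinguisher hf, (hζ αf hαf).trans ?_⟩
  have h₁ := abs_integral_unif_sub_le hnoise
  have h₂ := abs_integral_unif_sub_le hz₁
  have h₃ := abs_integral_mulVec_bits_sub_le hδ hdim (H := fun A s => ∫ E, ∫ x,
    f (liftSamples A E x) ∂(lweSamples k m q s (contGauss γ)) ∂dgm.toMeasure) fun A s =>
      ((hf.comp (measurable_liftSamples.comp (f := fun p :
        (Fin m → Fin n → ℤ) × (Fin m → Samp k q) => ((A, p.1), p.2)) (by fun_prop))).integral_right
          _).integral_mem _
  simp_rw [← integral_hintDistinguisher_extLWEm₀ hf] at h₃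
  rw [← integral_liftDistinguisher_stdLWESamples hf] at h₃
  rw [adv, adv, adv, adv, ← integral_liftDistinguisher_uniSamples hf,
    integral_uniDistinguisher_extLWEm₁ hf, binLWESamples, hf.integral_bind _ .of_discrete]
  change |(∫ z, ∫ x, f x ∂(lweSamples n m q (bits q z) (contGauss (αf z)))
    ∂(unif (Fin n → Bool))) - _| ≤ _
  simp only [adv] at h₂
  rw [abs_sub_comm] at h₂
  have h := (abs_sub_le _ _ _).trans (add_le_add ((abs_sub_le _ _ _).trans (add_le_add h₁ h₂)) h₃)
  refine (abs_sub_le _ (∫ x, liftDistinguisher f k dgm x ∂(uniSamples k m q)) _).trans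
    ((add_le_add_left ((abs_sub_le _ _ _).trans (add_le_add_left h _)) _).trans_eq ?_)
  ring

end LWEPaper
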